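/- Let d ≥ 1 be an integer and σ ≥ 2/d. Suppose Ψ is a global solution of the focusing nonlinear Schrödinger equation i∂_tΨ + ΔΨ + |Ψ|^{2σ}Ψ = 0, defined for all t ∈ [0,∞), such that t ↦ Ψ(t,·) is a smooth curve in the Schwartz space 𝒮(ℝ^d; ℂ), and suppose the Hamiltonian ℋ(Ψ(t)) = ∫ (½|∇Ψ(t,x)|² − (1/(2(σ+1)))|Ψ(t,x)|^{2σ+2}) dx is independent of t. Then ℋ(Ψ(0)) ≥ 0. Equivalently, any solution with negative energy cannot exist globally in time (Glassey's blow-up argument). -/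

import Mathlib

open MeasureTheory Filter

/-- The Laplacian of a complex-valued function: sum of second partial derivatives
in the coordinate directions. -/
noncomputable def lapC {d : ℕ} (f : EuclideanSpace ℝ (Fin d) → ℂ)
    (x : EuclideanSpace ℝ (Fin d)) : ℂ :=
  ∑ j, fderiv ℝ (fun y => fderiv ℝ f y (EuclideanSpace.single j 1)) x
    (EuclideanSpace.single j 1)

/-- A smooth curve in Schwartz space. -/
def SmoothSchwartzCurve {d : ℕ}
    (Ψ : ℝ → SchwartzMap (EuclideanSpace ℝ (Fin d)) ℂ) : Prop :=
  ∃ D : ℕ → ℝ → SchwartzMap (EuclideanSpace ℝ (Fin d)) ℂ, D 0 = Ψ ∧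
    ∀ n t, Tendsto (fun h : ℝ => (h⁻¹ : ℝ) • (D n (t + h) - D n t))
      (nhdsWithin 0 {(0 : ℝ)}ᶜ) (nhds (D (n + 1) t))

/-- The NLS Hamiltonian ℋ(ψ) = ∫ (½|∇ψ|² − (1/(2(σ+1)))|ψ|^{2σ+2}) dx. -/
noncomputable def nlsHamiltonian {d : ℕ} (σ : ℝ)
    (ψ : SchwartzMap (EuclideanSpace ℝ (Fin d)) ℂ) : ℝ :=
  ∫ x, ((1 : ℝ) / 2 * ∑ j, ‖fderiv ℝ (fun y => ψ y) x (EuclideanSpace.single j 1)‖ ^ 2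
    - 1 / (2 * (σ + 1)) * ‖ψ x‖ ^ (2 * σ + 2))

open scoped SchwartzMap LineDeriv ComplexConjugate

namespace Glassey

variable {d : ℕ}

/-- Multiplication by the `j`-th coordinate on Schwartz space. -/
noncomputable def coordMul (j : Fin d) :
    𝓢(EuclideanSpace ℝ (Fin d), ℂ) →L[ℂ] 𝓢(EuclideanSpace ℝ (Fin d), ℂ) :=
  SchwartzMap.smulLeftCLM ℂ (fun x : EuclideanSpace ℝ (Fin d) => ((x j : ℝ) : ℂ))

/-- The `j`-th partial derivative on Schwartz space. -/
noncomputable def partialDeriv (j : Fin d) :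
    𝓢(EuclideanSpace ℝ (Fin d), ℂ) →L[ℂ] 𝓢(EuclideanSpace ℝ (Fin d), ℂ) :=
  LineDeriv.lineDerivOpCLM ℂ 𝓢(EuclideanSpace ℝ (Fin d), ℂ)
    (EuclideanSpace.single j (1 : ℝ))

/-- The `L²` inner product of two Schwartz functions. -/
noncomputable def ip (f g : 𝓢(EuclideanSpace ℝ (Fin d), ℂ)) : ℂ :=
  inner ℂ (SchwartzMap.toLpCLM ℂ ℂ 2 volume f) (SchwartzMap.toLpCLM ℂ ℂ 2 volume g)

lemma coordMul_apply (j : Fin d) (f : 𝓢(EuclideanSpace ℝ (Fin d), ℂ))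
    (x : EuclideanSpace ℝ (Fin d)) : coordMul j f x = (x j : ℂ) * f x := by
  have h : (fun x : EuclideanSpace ℝ (Fin d) => ((x j : ℝ) : ℂ)).HasTemperateGrowth :=
    (Complex.ofRealCLM ∘L
      (EuclideanSpace.proj j : EuclideanSpace ℝ (Fin d) →L[ℝ] ℝ)).hasTemperateGrowth
  simp [coordMul, SchwartzMap.smulLeftCLM_apply_apply h]

lemma partialDeriv_apply (j : Fin d) (f : 𝓢(EuclideanSpace ℝ (Fin d), ℂ))
    (x : EuclideanSpace ℝ (Fin d)) :
    partialDeriv j f x = fderiv ℝ f x (EuclideanSpace.single j 1) := rfl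

lemma ip_eq_integral (f g : 𝓢(EuclideanSpace ℝ (Fin d), ℂ)) :
    ip f g = ∫ x, conj (f x) * g x := by
  simp [ip, mul_comm]

lemma ip_add_left (f g h : 𝓢(EuclideanSpace ℝ (Fin d), ℂ)) :
    ip (f + g) h = ip f h + ip g h := by simp only [ip, map_add, inner_add_left]

lemma ip_add_right (f g h : 𝓢(EuclideanSpace ℝ (Fin d), ℂ)) :
    ip f (g + h) = ip f g + ip f h := by simp only [ip, map_add, inner_add_right]

lemma ip_smul_left (c : ℂ) (f g : 𝓢(EuclideanSpace ℝ (Fin d), ℂ)) :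
    ip (c • f) g = conj c * ip f g := by simp only [ip, map_smul, inner_smul_left]

lemma ip_smul_right (c : ℂ) (f g : 𝓢(EuclideanSpace ℝ (Fin d), ℂ)) :
    ip f (c • g) = c * ip f g := by simp only [ip, map_smul, inner_smul_right]

lemma ip_sum_left {ι : Type*} (s : Finset ι) (f : ι → 𝓢(EuclideanSpace ℝ (Fin d), ℂ))
    (g : 𝓢(EuclideanSpace ℝ (Fin d), ℂ)) :
    ip (∑ i ∈ s, f i) g = ∑ i ∈ s, ip (f i) g := by simp only [ip, map_sum, sum_inner]

lemma ip_sum_right {ι : Type*} (s : Finset ι) (f : 𝓢(EuclideanSpace ℝ (Fin d), ℂ))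
    (g : ι → 𝓢(EuclideanSpace ℝ (Fin d), ℂ)) :
    ip f (∑ i ∈ s, g i) = ∑ i ∈ s, ip f (g i) := by simp only [ip, map_sum, inner_sum]

lemma conj_ip (f g : 𝓢(EuclideanSpace ℝ (Fin d), ℂ)) : conj (ip f g) = ip g f :=
  inner_conj_symm _ _

lemma ip_self_im (f : 𝓢(EuclideanSpace ℝ (Fin d), ℂ)) : (ip f f).im = 0 :=
  Complex.conj_eq_iff_im.1 (conj_ip f f)

lemma ip_self_re_nonneg (f : 𝓢(EuclideanSpace ℝ (Fin d), ℂ)) : 0 ≤ (ip f f).re :=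
  inner_self_nonneg (𝕜 := ℂ) (x := SchwartzMap.toLpCLM ℂ ℂ 2 volume f)

lemma integrable_conj_mul (f g : 𝓢(EuclideanSpace ℝ (Fin d), ℂ)) :
    Integrable (fun x => conj (f x) * g x) := by
  have := L2.integrable_inner (𝕜 := ℂ) (f.toLp 2 volume) (g.toLp 2 volume)
  refine this.congr ?_
  filter_upwards [f.coeFn_toLp 2 volume, g.coeFn_toLp 2 volume] with x hf hg
  rw [hf, hg, RCLike.inner_apply, mul_comm]

lemma ip_re (f g : 𝓢(EuclideanSpace ℝ (Fin d), ℂ)) :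
    (ip f g).re = ∫ x, (conj (f x) * g x).re := by
  rw [ip_eq_integral]
  exact (integral_re (integrable_conj_mul f g)).symm

lemma ip_coordMul_left (j : Fin d) (f g : 𝓢(EuclideanSpace ℝ (Fin d), ℂ)) :
    ip (coordMul j f) g = ip f (coordMul j g) := by
  simp only [ip_eq_integral, coordMul_apply, map_mul, Complex.conj_ofReal]
  congr with x
  ring

lemma ip_partialDeriv_left (j : Fin d) (f g : 𝓢(EuclideanSpace ℝ (Fin d), ℂ)) :
    ip (partialDeriv j f) g = -ip f (partialDeriv j g) := by
  have h := SchwartzMap.integral_bilinear_lineDerivOp_right_eq_neg_left (μ := volume) f g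
    ((ContinuousLinearMap.mul ℝ ℂ).comp (Complex.conjCLE : ℂ →L[ℝ] ℂ))
    (EuclideanSpace.single j (1 : ℝ))
  rw [ip_eq_integral, ip_eq_integral, eq_neg_iff_add_eq_zero, add_comm, ← eq_neg_iff_add_eq_zero]
  exact h

lemma partialDeriv_coordMul (k j : Fin d) (f : 𝓢(EuclideanSpace ℝ (Fin d), ℂ)) :
    partialDeriv k (coordMul j f)
      = coordMul j (partialDeriv k f) + if k = j then f else 0 := by
  ext x
  have h1 : HasFDerivAt (fun x : EuclideanSpace ℝ (Fin d) => ((x j : ℝ) : ℂ))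
    (Complex.ofRealCLM ∘L (EuclideanSpace.proj j : EuclideanSpace ℝ (Fin d) →L[ℝ] ℝ)) x :=
    (Complex.ofRealCLM ∘L
      (EuclideanSpace.proj j : EuclideanSpace ℝ (Fin d) →L[ℝ] ℝ)).hasFDerivAt
  have h3 : (coordMul j f : EuclideanSpace ℝ (Fin d) → ℂ) = fun x => ((x j : ℝ) : ℂ) * f x :=
    funext (coordMul_apply j f)
  have h2 : HasFDerivAt (fun x : EuclideanSpace ℝ (Fin d) => ((x j : ℝ) : ℂ) * f x) _ x :=
    h1.mul (f.hasFDerivAt x)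
  rw [partialDeriv_apply, h3, h2.fderiv]
  by_cases hkj : k = j
  · subst hkj
    simp [coordMul_apply, partialDeriv_apply]
  · simp [coordMul_apply, partialDeriv_apply, hkj, Ne.symm hkj]

lemma partialDeriv_comm (k j : Fin d) (f : 𝓢(EuclideanSpace ℝ (Fin d), ℂ)) :
    partialDeriv k (partialDeriv j f) = partialDeriv j (partialDeriv k f) := by
  ext x
  have hd : DifferentiableAt ℝ (fderiv ℝ f) x :=
    (SchwartzMap.fderivCLM ℝ (EuclideanSpace ℝ (Fin d)) ℂ f).differentiableAt
  have key (i l : Fin d) : partialDeriv i (partialDeriv l f) x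
      = fderiv ℝ (fderiv ℝ f) x (EuclideanSpace.single i 1) (EuclideanSpace.single l 1) := by
    have h3 : (partialDeriv l f : EuclideanSpace ℝ (Fin d) → ℂ)
        = fun x => fderiv ℝ f x (EuclideanSpace.single l 1) := rfl
    rw [partialDeriv_apply, h3, fderiv_clm_apply hd (differentiableAt_const _)]
    simp
  rw [key, key]
  have := (f.smooth 2).contDiffAt (x := x)
  exact this.isSymmSndFDerivAt (by simp) _ _

lemma ip_coordMul_partialDeriv (j : Fin d) (w z : 𝓢(EuclideanSpace ℝ (Fin d), ℂ)) :
    ip w (coordMul j (partialDeriv j z)) = -ip w z - ip (coordMul j (partialDeriv j w)) z := by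
  have h := ip_partialDeriv_left j (coordMul j w) z
  rw [partialDeriv_coordMul, if_pos rfl, ip_add_left, ip_coordMul_left j w] at h
  linear_combination h

lemma two_mul_ip_coordMul_partialDeriv_self_re (j : Fin d)
    (w : 𝓢(EuclideanSpace ℝ (Fin d), ℂ)) :
    2 * (ip w (coordMul j (partialDeriv j w))).re = -(ip w w).re := by
  have h := congrArg Complex.re (ip_coordMul_partialDeriv j w w)
  rw [← conj_ip w (coordMul j (partialDeriv j w))] at h
  simp only [Complex.sub_re, Complex.neg_re, Complex.conj_re] at h
  linarith

lemma ip_coordMul_coordMul_partialDeriv_sq (j k : Fin d)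
    (u : 𝓢(EuclideanSpace ℝ (Fin d), ℂ)) :
    (ip (coordMul j u) (coordMul j (partialDeriv k (partialDeriv k u)))).im
      = if k = j then -2 * (ip u (coordMul j (partialDeriv j u))).im else 0 := by
  have h := ip_partialDeriv_left k (coordMul j (coordMul j u)) (partialDeriv k u)
  rw [ip_coordMul_left j (coordMul j u), partialDeriv_coordMul, partialDeriv_coordMul] at h
  have h0 := ip_self_im (coordMul j (partialDeriv k u))
  rw [← neg_eq_iff_eq_neg] at h
  rw [← h]
  split_ifs with hkj
  · subst hkj
    simp only [map_add, ip_add_left, Complex.neg_im, Complex.add_im,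
      ip_coordMul_left k u, ip_coordMul_left k (coordMul k (partialDeriv k u)), h0]
    ring
  · simp [ip_coordMul_left j (coordMul j (partialDeriv k u)), h0]

lemma ip_I_smul_right_re (f g : 𝓢(EuclideanSpace ℝ (Fin d), ℂ)) :
    (ip f (Complex.I • g)).re = -(ip f g).im := by
  simp [ip_smul_right]

lemma ip_I_smul_left_im (f g : 𝓢(EuclideanSpace ℝ (Fin d), ℂ)) :
    (ip (Complex.I • f) g).im = -(ip f g).re := by
  simp [ip_smul_left]

lemma ip_coordMul_real_multiple_im (j : Fin d) (u N : 𝓢(EuclideanSpace ℝ (Fin d), ℂ))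
    (r : EuclideanSpace ℝ (Fin d) → ℝ) (hN : ∀ x, N x = (r x : ℂ) * u x) :
    (ip (coordMul j u) (coordMul j N)).im = 0 := by
  rw [← Complex.conj_eq_iff_im, conj_ip, ip_eq_integral, ip_eq_integral]
  congr with x
  simp only [coordMul_apply, hN, map_mul, Complex.conj_ofReal]
  ring

lemma sum_ip_coordMul_coordMul_re (u v N : 𝓢(EuclideanSpace ℝ (Fin d), ℂ))
    (r : EuclideanSpace ℝ (Fin d) → ℝ) (hN : ∀ x, N x = (r x : ℂ) * u x)
    (hv : v = Complex.I • ((∑ k, partialDeriv k (partialDeriv k u)) + N)) :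
    ∑ j, (ip (coordMul j u) (coordMul j v)).re
      = 2 * ∑ j, (ip u (coordMul j (partialDeriv j u))).im := by
  rw [Finset.mul_sum]
  refine Finset.sum_congr rfl fun j _ => ?_
  rw [hv, map_smul, ip_I_smul_right_re, map_add, map_sum, ip_add_right, ip_sum_right,
    Complex.add_im, Complex.im_sum, ip_coordMul_real_multiple_im j u N r hN]
  simp only [ip_coordMul_coordMul_partialDeriv_sq]
  simp

lemma norm_rpow_eq_re {σ : ℝ} (hσ : 0 < σ) (u N : 𝓢(EuclideanSpace ℝ (Fin d), ℂ))
    (hN : ∀ x, N x = ((‖u x‖ ^ (2 * σ) : ℝ) : ℂ) * u x) (x : EuclideanSpace ℝ (Fin d)) :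
    ‖u x‖ ^ (2 * σ + 2) = (conj (N x) * u x).re := by
  have h : 2 * σ + 2 ≠ 0 := by positivity
  rw [Real.rpow_add' (norm_nonneg _) h, Real.rpow_two, ← Complex.normSq_eq_norm_sq, hN, map_mul,
    Complex.conj_ofReal, mul_assoc, Complex.re_ofReal_mul, ← Complex.normSq_eq_conj_mul_self,
    Complex.ofReal_re]

lemma ip_nonlinearity_dilation {σ : ℝ} (hσ : 0 < σ) (j : Fin d)
    (u N : 𝓢(EuclideanSpace ℝ (Fin d), ℂ))
    (hN : ∀ x, N x = ((‖u x‖ ^ (2 * σ) : ℝ) : ℂ) * u x) :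
    (2 * σ + 2) * (ip N (coordMul j (partialDeriv j u))).re = -(ip N u).re := by
  have hf (x : EuclideanSpace ℝ (Fin d)) :
      HasLineDerivAt ℝ (fun x => ‖u x‖ ^ (2 * σ + 2))
        ((2 * σ + 2) * (conj (N x) * partialDeriv j u x).re) x (EuclideanSpace.single j 1) := by
    have h := ((hasFDerivAt_norm_rpow (u x) (p := 2 * σ + 2) (by linarith)).comp x
      (u.hasFDerivAt x)).hasLineDerivAt (EuclideanSpace.single j 1)
    have h' : (2 * σ + 2) * (conj (N x) * partialDeriv j u x).re
        = (2 * σ + 2) * ‖u x‖ ^ (2 * σ + 2 - 2) * inner ℝ (u x) (partialDeriv j u x) := by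
      rw [add_sub_cancel_right, Complex.inner, hN, map_mul, Complex.conj_ofReal, mul_assoc,
        Complex.re_ofReal_mul, mul_assoc, mul_comm (conj (u x))]
    rw [h']
    exact h
  have hg (x : EuclideanSpace ℝ (Fin d)) :
      HasLineDerivAt ℝ (fun x : EuclideanSpace ℝ (Fin d) => x j) 1 x
        (EuclideanSpace.single j 1) := by
    have h := ((EuclideanSpace.proj j : EuclideanSpace ℝ (Fin d) →L[ℝ] ℝ).hasFDerivAt
      (x := x)).hasLineDerivAt (EuclideanSpace.single j 1)
    simpa using h
  have h1 (x : EuclideanSpace ℝ (Fin d)) :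
      (2 * σ + 2) * (conj (N x) * partialDeriv j u x).re * x j
        = (2 * σ + 2) * (conj (N x) * coordMul j (partialDeriv j u) x).re := by
    rw [coordMul_apply, mul_left_comm, Complex.re_ofReal_mul]
    ring
  have h2 (x : EuclideanSpace ℝ (Fin d)) :
      ‖u x‖ ^ (2 * σ + 2) * x j = (conj (N x) * coordMul j u x).re := by
    rw [coordMul_apply, mul_left_comm, Complex.re_ofReal_mul, norm_rpow_eq_re hσ u N hN]
    ring
  have key := integral_bilinear_hasLineDerivAt_right_eq_neg_left_of_integrable
    (μ := (volume : Measure (EuclideanSpace ℝ (Fin d))))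
    (B := ContinuousLinearMap.mul ℝ ℝ) (g' := fun _ => 1)
    (f' := fun x => (2 * σ + 2) * (conj (N x) * partialDeriv j u x).re)
    (f := fun x => ‖u x‖ ^ (2 * σ + 2)) (g := fun x => x j)
    (v := EuclideanSpace.single j (1 : ℝ))
    (by
      simp only [ContinuousLinearMap.mul_apply', h1]
      exact (integrable_conj_mul _ _).re.const_mul _)
    (by
      simp only [ContinuousLinearMap.mul_apply', mul_one, norm_rpow_eq_re hσ u N hN]
      exact (integrable_conj_mul _ _).re)
    (by
      simp only [ContinuousLinearMap.mul_apply', h2]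
      exact (integrable_conj_mul _ _).re)
    (fun x _ => hf x) (fun x _ => hg x)
  simp only [ContinuousLinearMap.mul_apply', mul_one, h1, norm_rpow_eq_re hσ u N hN,
    integral_const_mul, ← ip_re] at key
  linarith

lemma virial_identity {σ : ℝ} (hσ : 0 < σ) (u v N : 𝓢(EuclideanSpace ℝ (Fin d), ℂ))
    (hN : ∀ x, N x = ((‖u x‖ ^ (2 * σ) : ℝ) : ℂ) * u x)
    (hv : v = Complex.I • ((∑ k, partialDeriv k (partialDeriv k u)) + N)) :
    ∑ j, (ip v (coordMul j (partialDeriv j u)) + ip u (coordMul j (partialDeriv j v))).im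
      = 2 * ∑ j, (ip (partialDeriv j u) (partialDeriv j u)).re
        - d * σ / (σ + 1) * (ip N u).re := by
  have im_ip_v (z : 𝓢(EuclideanSpace ℝ (Fin d), ℂ)) :
      (ip v z).im = ∑ k, (ip (partialDeriv k u) (partialDeriv k z)).re - (ip N z).re := by
    rw [hv, ip_I_smul_left_im, ip_add_left, ip_sum_left]
    simp only [ip_partialDeriv_left _ (partialDeriv _ u), Complex.add_re, Complex.re_sum,
      Complex.neg_re, Finset.sum_neg_distrib]
    ring
  have term (j : Fin d) :
      (ip v (coordMul j (partialDeriv j u)) + ip u (coordMul j (partialDeriv j v))).im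
        = 2 * (ip (partialDeriv j u) (partialDeriv j u)).re - σ / (σ + 1) * (ip N u).re := by
    have hN' := ip_nonlinearity_dilation hσ j u N hN
    have h1 : (ip v (coordMul j (partialDeriv j u)) + ip u (coordMul j (partialDeriv j v))).im
        = 2 * (ip v (coordMul j (partialDeriv j u))).im + (ip v u).im := by
      rw [ip_coordMul_partialDeriv j u v, ← conj_ip v u, ← conj_ip v (coordMul j _)]
      simp only [Complex.add_im, Complex.sub_im, Complex.neg_im, Complex.conj_im]
      ring
    have h2 (k : Fin d) :
        2 * (ip (partialDeriv k u) (partialDeriv k (coordMul j (partialDeriv j u)))).re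
            + (ip (partialDeriv k u) (partialDeriv k u)).re
          = if k = j then 2 * (ip (partialDeriv j u) (partialDeriv j u)).re else 0 := by
      have h3 := two_mul_ip_coordMul_partialDeriv_self_re j (partialDeriv k u)
      rw [partialDeriv_coordMul, ip_add_right, Complex.add_re, mul_add, partialDeriv_comm k j, h3]
      split_ifs with hkj
      · subst hkj; ring
      · simp [ip]
    have h4 : ∑ k, (2 * (ip (partialDeriv k u) (partialDeriv k (coordMul j (partialDeriv j u)))).re
            + (ip (partialDeriv k u) (partialDeriv k u)).re)
          = 2 * (ip (partialDeriv j u) (partialDeriv j u)).re := by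
      simp only [h2]
      simp
    rw [Finset.sum_add_distrib, ← Finset.mul_sum] at h4
    rw [h1, im_ip_v, im_ip_v]
    have h5 : (ip N (coordMul j (partialDeriv j u))).re = -(ip N u).re / (2 * σ + 2) := by
      field_simp
      linarith
    rw [h5]
    have : σ + 1 ≠ 0 := by positivity
    have h6 : σ / (σ + 1) * (ip N u).re = 2 * (-(ip N u).re / (2 * σ + 2)) + (ip N u).re := by
      field_simp
      ring
    rw [h6]
    linarith
  simp only [term, Finset.sum_sub_distrib, Finset.sum_const, Finset.card_univ, Fintype.card_fin,
    nsmul_eq_mul, ← Finset.mul_sum]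
  ring

lemma hasDerivAt_clm_comp_of_tendsto {V G : Type*} [AddCommGroup V] [Module ℝ V]
    [TopologicalSpace V] [NormedAddCommGroup G] [NormedSpace ℝ G] (L : V →L[ℝ] G)
    {f : ℝ → V} {f' : V} {t : ℝ}
    (h : Tendsto (fun h : ℝ => (h⁻¹ : ℝ) • (f (t + h) - f t)) (nhdsWithin 0 {(0 : ℝ)}ᶜ) (nhds f')) :
    HasDerivAt (fun s => L (f s)) (L f') t := by
  rw [hasDerivAt_iff_tendsto_slope_zero]
  simpa [Function.comp_def] using (L.continuous.tendsto f').comp h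

lemma hasDerivAt_ip {f g : ℝ → 𝓢(EuclideanSpace ℝ (Fin d), ℂ)}
    {f' g' : 𝓢(EuclideanSpace ℝ (Fin d), ℂ)} {t : ℝ}
    (S T : 𝓢(EuclideanSpace ℝ (Fin d), ℂ) →L[ℂ] 𝓢(EuclideanSpace ℝ (Fin d), ℂ))
    (hf : Tendsto (fun h : ℝ => (h⁻¹ : ℝ) • (f (t + h) - f t))
      (nhdsWithin 0 {(0 : ℝ)}ᶜ) (nhds f'))
    (hg : Tendsto (fun h : ℝ => (h⁻¹ : ℝ) • (g (t + h) - g t))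
      (nhdsWithin 0 {(0 : ℝ)}ᶜ) (nhds g')) :
    HasDerivAt (fun s => ip (S (f s)) (T (g s))) (ip (S (f t)) (T g') + ip (S f') (T (g t))) t :=
  (hasDerivAt_clm_comp_of_tendsto
    (((SchwartzMap.toLpCLM ℂ ℂ 2 volume).comp S).restrictScalars ℝ) hf).inner ℂ
  (hasDerivAt_clm_comp_of_tendsto
    (((SchwartzMap.toLpCLM ℂ ℂ 2 volume).comp T).restrictScalars ℝ) hg)

lemma nlsHamiltonian_eq {σ : ℝ} (hσ : 0 < σ) (u N : 𝓢(EuclideanSpace ℝ (Fin d), ℂ))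
    (hN : ∀ x, N x = ((‖u x‖ ^ (2 * σ) : ℝ) : ℂ) * u x) :
    nlsHamiltonian σ u = 1 / 2 * ∑ j, (ip (partialDeriv j u) (partialDeriv j u)).re
      - 1 / (2 * (σ + 1)) * (ip N u).re := by
  have h1 (j : Fin d) (x : EuclideanSpace ℝ (Fin d)) :
      ‖fderiv ℝ (fun y => u y) x (EuclideanSpace.single j 1)‖ ^ 2
        = (conj (partialDeriv j u x) * partialDeriv j u x).re := by
    rw [← Complex.normSq_eq_conj_mul_self, Complex.ofReal_re, Complex.normSq_eq_norm_sq]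
    rfl
  simp only [nlsHamiltonian, h1, norm_rpow_eq_re hσ u N hN, ip_re]
  rw [integral_sub, integral_const_mul, integral_const_mul, integral_finsetSum]
  · exact fun j _ => (integrable_conj_mul _ _).re
  · exact (integrable_finsetSum _ fun j _ => (integrable_conj_mul _ _).re).const_mul _
  · exact (integrable_conj_mul _ _).re.const_mul _

/-- If the second derivative of a nonnegative function is at most `c` on `[0, ∞)`, then `0 ≤ c`. -/
lemma nonneg_of_second_deriv_le {y M M' : ℝ → ℝ} {c : ℝ} (hy0 : ∀ t, 0 ≤ y t)
    (hy : ∀ t ≥ 0, HasDerivAt y (M t) t) (hM : ∀ t ≥ 0, HasDerivAt M (M' t) t)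
    (hc : ∀ t ≥ 0, M' t ≤ c) : 0 ≤ c := by
  have anti {f f' : ℝ → ℝ} (hf : ∀ t ≥ 0, HasDerivAt f (f' t) t) (hf' : ∀ t ≥ 0, f' t ≤ 0)
      (t : ℝ) (ht : 0 ≤ t) : f t ≤ f 0 := by
    refine antitoneOn_of_hasDerivWithinAt_nonpos (convex_Ici 0) (f' := f')
      (fun s hs => (hf s hs).continuousAt.continuousWithinAt) (fun s hs => ?_) (fun s hs => ?_)
      Set.self_mem_Ici ht ht
    · exact (hf s (interior_subset hs)).hasDerivWithinAt
    · exact hf' s (interior_subset hs)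
  have hM_le (t : ℝ) (ht : 0 ≤ t) : M t - c * t ≤ M 0 - c * 0 :=
    anti (f := fun t => M t - c * t) (f' := fun t => M' t - c * 1)
      (fun s hs => (hM s hs).sub ((hasDerivAt_id s).const_mul c))
      (fun s hs => by linarith [hc s hs]) t ht
  have hy_le (t : ℝ) (ht : 0 ≤ t) :
      y t - (M 0 * t + c / 2 * t ^ 2) ≤ y 0 - (M 0 * 0 + c / 2 * 0 ^ 2) :=
    anti (f := fun t => y t - (M 0 * t + c / 2 * t ^ 2))
      (f' := fun t => M t - (M 0 * 1 + c / 2 * ((2 : ℕ) * t ^ (2 - 1))))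
      (fun s hs => (hy s hs).sub
        (((hasDerivAt_id s).const_mul (M 0)).add ((hasDerivAt_pow 2 s).const_mul (c / 2))))
      (fun s hs => by have := hM_le s hs; norm_num; linarith) t ht
  by_contra! hneg
  have hlim : Tendsto (fun t : ℝ => t * (M 0 + c / 2 * t)) atTop atBot :=
    tendsto_id.atTop_mul_atBot₀
      (tendsto_atBot_add_const_left _ _ (tendsto_id.const_mul_atTop_of_neg (by linarith)))
  obtain ⟨t, ht, ht0⟩ := ((hlim.eventually_lt_atBot (-y 0)).and (eventually_ge_atTop 0)).exists
  nlinarith [hy_le t ht0, hy0 t]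

end Glassey

open Glassey

/-- Glassey's blow-up argument: for σ ≥ 2/d, a global-in-time Schwartz solution of
the focusing NLS with conserved Hamiltonian must have nonnegative energy; i.e. negative
energy solutions cannot exist globally. -/
theorem glassey_blowup (d : ℕ) (hd : 1 ≤ d) (σ : ℝ) (hσ : 2 / (d : ℝ) ≤ σ)
    (Ψ : ℝ → SchwartzMap (EuclideanSpace ℝ (Fin d)) ℂ)
    (hsmooth : SmoothSchwartzCurve Ψ)
    (hNLS : ∀ t ≥ (0 : ℝ), ∀ x : EuclideanSpace ℝ (Fin d),
      Complex.I * deriv (fun s => Ψ s x) t + lapC (fun y => Ψ t y) x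
        + ((‖Ψ t x‖ ^ (2 * σ) : ℝ) : ℂ) * Ψ t x = 0)
    (hcons : ∀ t ≥ (0 : ℝ), nlsHamiltonian σ (Ψ t) = nlsHamiltonian σ (Ψ 0)) :
    0 ≤ nlsHamiltonian σ (Ψ 0) := by
  obtain ⟨D, hD0, hD⟩ := hsmooth
  have hd0 : (0 : ℝ) < d := by exact_mod_cast hd
  have hσ0 : 0 < σ := lt_of_lt_of_le (by positivity) hσ
  have hdσ : 2 ≤ d * σ := by rwa [div_le_iff₀' hd0] at hσ
  have hΨ (t : ℝ) : Tendsto (fun h : ℝ => (h⁻¹ : ℝ) • (Ψ (t + h) - Ψ t))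
      (nhdsWithin 0 {(0 : ℝ)}ᶜ) (nhds (D 1 t)) := by
    simpa [hD0] using hD 0 t
  have hderiv (t : ℝ) (x : EuclideanSpace ℝ (Fin d)) : deriv (fun s => Ψ s x) t = D 1 t x :=
    (hasDerivAt_clm_comp_of_tendsto
      ((BoundedContinuousFunction.evalCLM ℝ x).comp
        (SchwartzMap.toBoundedContinuousFunctionCLM ℝ (EuclideanSpace ℝ (Fin d)) ℂ))
      (hΨ t)).deriv
  let N (t : ℝ) : SchwartzMap (EuclideanSpace ℝ (Fin d)) ℂ :=
    -(Complex.I • D 1 t) - ∑ k, partialDeriv k (partialDeriv k (Ψ t))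
  have hN (t : ℝ) (ht : 0 ≤ t) (x : EuclideanSpace ℝ (Fin d)) :
      N t x = ((‖Ψ t x‖ ^ (2 * σ) : ℝ) : ℂ) * Ψ t x := by
    have h1 : lapC (fun y => Ψ t y) x = ∑ k, partialDeriv k (partialDeriv k (Ψ t)) x := rfl
    have h2 := hNLS t ht x
    rw [hderiv, h1] at h2
    simp only [N, sub_apply, neg_apply, smul_apply, sum_apply, smul_eq_mul]
    linear_combination -h2
  have hv (t : ℝ) :
      D 1 t = Complex.I • ((∑ k, partialDeriv k (partialDeriv k (Ψ t))) + N t) := by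
    simp [N, smul_smul]
  let y (t : ℝ) : ℝ := ∑ j, (ip (coordMul j (Ψ t)) (coordMul j (Ψ t))).re
  let M (t : ℝ) : ℝ := 4 * ∑ j, (ip (Ψ t) (coordMul j (partialDeriv j (Ψ t)))).im
  have hy (t : ℝ) (ht : 0 ≤ t) : HasDerivAt y (M t) t := by
    have h : HasDerivAt y (∑ j, (ip (coordMul j (Ψ t)) (coordMul j (D 1 t))
        + ip (coordMul j (D 1 t)) (coordMul j (Ψ t))).re) t :=
      HasDerivAt.fun_sum fun j _ =>
        Complex.reCLM.hasFDerivAt.comp_hasDerivAt t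
          (hasDerivAt_ip (coordMul j) (coordMul j) (hΨ t) (hΨ t))
    convert h using 1
    have h2 := sum_ip_coordMul_coordMul_re _ _ _ _ (hN t ht) (hv t)
    simp only [Complex.add_re, ← conj_ip (coordMul _ (Ψ t)) (coordMul _ (D 1 t)),
      Complex.conj_re, Finset.sum_add_distrib, h2, M]
    ring
  have hM (t : ℝ) (ht : 0 ≤ t) : HasDerivAt M
      (4 * (2 * ∑ j, (ip (partialDeriv j (Ψ t)) (partialDeriv j (Ψ t))).re
        - d * σ / (σ + 1) * (ip (N t) (Ψ t)).re)) t := by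
    rw [← virial_identity hσ0 _ _ _ (hN t ht) (hv t)]
    refine (HasDerivAt.fun_sum fun j _ => ?_).const_mul 4
    rw [add_comm]
    exact Complex.imCLM.hasFDerivAt.comp_hasDerivAt t
      (hasDerivAt_ip (.id ℂ _) ((coordMul j).comp (partialDeriv j)) (hΨ t) (hΨ t))
  have key : 0 ≤ 16 * nlsHamiltonian σ (Ψ 0) := by
    refine nonneg_of_second_deriv_le
      (fun t => Finset.sum_nonneg fun j _ => ip_self_re_nonneg _) hy hM fun t ht => ?_
    rw [← hcons t ht, nlsHamiltonian_eq hσ0 _ _ (hN t ht)]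
    have hQ : 0 ≤ (ip (N t) (Ψ t)).re := by
      rw [ip_re]
      refine integral_nonneg fun x => ?_
      rw [← norm_rpow_eq_re hσ0 _ _ (hN t ht)]
      positivity
    have h3 : 2 * ((ip (N t) (Ψ t)).re / (σ + 1)) ≤ d * σ * ((ip (N t) (Ψ t)).re / (σ + 1)) := by
      gcongr
    have h4 : 1 / (2 * (σ + 1)) * (ip (N t) (Ψ t)).re = (ip (N t) (Ψ t)).re / (σ + 1) / 2 := by
      field_simp
    rw [h4, div_mul_eq_mul_div, mul_div_assoc]
    linarith
  linarith
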